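/- Let k = |B|^t − |B|^{t−1}, let α*, ᾱ ∈ F be distinct, and let u ∈ F satisfy Tr_{F/B}(u(ᾱ − α*)) = 0. Then for every polynomial f ∈ F[x] with deg f ≤ k − 1, the repair equation avoiding ᾱ holds: Tr_{F/B}(u·f(α*)) = − Σ_{α ∈ F \ {α*, ᾱ}} Tr_{F/B}(u(α − α*)) · Tr_{F/B}(f(α)/(α − α*)). -/

import Mathlib

open Polynomial

/-- The field trace `Tr_{F/B}(x) = ∑_{i=0}^{t-1} x^{q^i}` (with `q = |B|`). -/
noncomputable def fTr (q t : ℕ) {F : Type*} [Field F] (x : F) : F :=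
  ∑ i ∈ Finset.range t, x ^ q ^ i

/-- `fTr` is the field trace. -/
theorem fTr_eq_algebraMap_trace {B F : Type*} [Field B] [Field F] [Algebra B F]
    [Fintype B] [Fintype F] {t : ℕ} (hF : Fintype.card F = Fintype.card B ^ t) (x : F) :
    fTr (Fintype.card B) t x = algebraMap B F (Algebra.trace B F x) := by
  have ht : Module.finrank B F = t :=
    Nat.pow_right_injective Fintype.one_lt_card
      ((Module.card_eq_pow_finrank (K := B) (V := F)).symm.trans hF)
  rw [FiniteField.algebraMap_trace_eq_sum_pow, ht, Nat.card_eq_fintype_card, fTr]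

/-- The values of a polynomial of degree less than `|F| - 1` sum to zero over `F`. -/
theorem sum_eval_eq_zero_of_natDegree_lt {F : Type*} [Field F] [Fintype F] (g : F[X])
    (hg : g.natDegree < Fintype.card F - 1) : ∑ x : F, g.eval x = 0 := by
  simp_rw [eval_eq_sum_range]
  rw [Finset.sum_comm]
  refine Finset.sum_eq_zero fun i hi => ?_
  rw [← Finset.mul_sum, FiniteField.sum_pow_lt_card_sub_one, mul_zero]
  have := Finset.mem_range.mp hi
  omega

/-- The polynomial `Tr(u(X - a)) / (X - a)`. -/
noncomputable def repairPoly (q t : ℕ) {F : Type*} [Field F] (u a : F) : F[X] :=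
  ∑ i ∈ Finset.range t, C (u ^ q ^ i) * (X - C a) ^ (q ^ i - 1)

theorem repairPoly_eval_self {F : Type*} [Field F] {q t : ℕ} (hq : 1 < q) (ht : 0 < t)
    (u a : F) : (repairPoly q t u a).eval a = u := by
  rw [repairPoly, eval_finsetSum, Finset.sum_eq_single_of_mem 0 (Finset.mem_range.mpr ht)]
  · simp
  · intro i _ hi
    have : q ^ i - 1 ≠ 0 := Nat.sub_ne_zero_of_lt (Nat.one_lt_pow hi hq)
    simp [this]

theorem repairPoly_eval_of_ne {F : Type*} [Field F] {q t : ℕ} (hq : 0 < q)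
    (u : F) {a x : F} (hx : x ≠ a) :
    (repairPoly q t u a).eval x = fTr q t (u * (x - a)) / (x - a) := by
  have hxa : x - a ≠ 0 := sub_ne_zero.mpr hx
  rw [repairPoly, eval_finsetSum, eq_div_iff hxa, Finset.sum_mul, fTr]
  refine Finset.sum_congr rfl fun i _ => ?_
  simp only [eval_mul, eval_C, eval_pow, eval_sub, eval_X]
  rw [mul_assoc, pow_sub_one_mul (Nat.pow_pos hq).ne', mul_pow]

theorem natDegree_repairPoly_le {F : Type*} [Field F] {q : ℕ} (hq : 0 < q) (t : ℕ) (u a : F) :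
    (repairPoly q t u a).natDegree ≤ q ^ (t - 1) - 1 := by
  refine natDegree_sum_le_of_forall_le _ _ fun i hi => ?_
  refine (natDegree_C_mul_le _ _).trans ?_
  rw [natDegree_pow, natDegree_X_sub_C, mul_one]
  have := Finset.mem_range.mp hi
  exact Nat.sub_le_sub_right (Nat.pow_le_pow_right hq (by omega)) 1

/-- With `k = |B|^t - |B|^{t-1}`, distinct `α*, ᾱ ∈ F`, and `u ∈ F` with
`Tr(u(ᾱ-α*)) = 0`: for every `f` with `deg f ≤ k - 1`, the repair equation avoiding `ᾱ`
holds: `Tr(u·f(α*)) = - ∑_{α ∉ {α*, ᾱ}} Tr(u(α-α*)) · Tr(f(α)/(α-α*))`. -/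
theorem stmt9 (p m t : ℕ) (hp : p.Prime) (hm : 0 < m) (ht : 0 < t)
    (B F : Type*) [Field B] [Field F] [Algebra B F] [Fintype B] [Fintype F] [DecidableEq F]
    (hB : Fintype.card B = p ^ m) (hF : Fintype.card F = Fintype.card B ^ t)
    (k : ℕ) (hk : k = Fintype.card B ^ t - Fintype.card B ^ (t - 1))
    (αs αb : F) (hne : αs ≠ αb)
    (u : F) (hu : fTr (Fintype.card B) t (u * (αb - αs)) = 0)
    (f : Polynomial F) (hf : f.degree ≤ ((k - 1 : ℕ) : WithBot ℕ)) :
    fTr (Fintype.card B) t (u * f.eval αs)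
      = - ∑ α ∈ (Finset.univ : Finset F) \ {αs, αb},
          fTr (Fintype.card B) t (u * (α - αs))
            * fTr (Fintype.card B) t (f.eval α / (α - αs)) := by
  have hq : 1 < Fintype.card B := Fintype.one_lt_card
  have hlt : Fintype.card B ^ (t - 1) < Fintype.card B ^ t :=
    Nat.pow_lt_pow_right hq (by omega)
  have hpos : 0 < Fintype.card B ^ (t - 1) := by positivity
  have hdeg : (f * repairPoly (Fintype.card B) t u αs).natDegree < Fintype.card F - 1 := by
    have hf' := natDegree_le_of_degree_le hf
    have hP' := natDegree_repairPoly_le (zero_lt_one.trans hq) t u αs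
    have := natDegree_mul_le (p := f) (q := repairPoly (Fintype.card B) t u αs)
    rw [hF]
    generalize Fintype.card B ^ t = Q, Fintype.card B ^ (t - 1) = R at *
    omega
  have hsum := sum_eval_eq_zero_of_natDegree_lt _ hdeg
  rw [← Finset.sum_sdiff (Finset.subset_univ {αs, αb}), Finset.sum_pair hne] at hsum
  simp only [eval_mul, repairPoly_eval_self hq ht,
    repairPoly_eval_of_ne (zero_lt_one.trans hq) u hne.symm, hu, zero_div, mul_zero,
    add_zero] at hsum
  rw [mul_comm u, ← neg_eq_of_add_eq_zero_right hsum]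
  simp only [fTr_eq_algebraMap_trace hF]
  rw [map_neg, map_neg, map_sum, map_sum]
  refine congrArg _ (Finset.sum_congr rfl fun α hα => ?_)
  have hα' : α ≠ αs := by
    rintro rfl
    simp at hα
  rw [repairPoly_eval_of_ne (zero_lt_one.trans hq) u hα', fTr_eq_algebraMap_trace hF,
    ← map_mul, ← smul_eq_mul (Algebra.trace B F _), ← map_smul, Algebra.smul_def]
  congr 2
  ring
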